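/- Let N ≥ 1, p > 1, λ > 0 and A ≥ 2λ, and define ψ(t,x) = A + |x|²/(1+t) and Ψ(t,x) = ψ(t,x)^λ. Let T > 0 and let u : [0,T] × ℝ^N → ℝ be a C² function such that there is a compact set K ⊆ ℝ^N with u(t,x) = 0 for all t ∈ [0,T] and x ∉ K, and such that u solves the damped wave equation ∂_t²u − Δu + ∂_t u = |u|^p on (0,T) × ℝ^N with initial data u(0,·) = u₀. Define the weighted energy E_Ψ(t) = ∫_{ℝ^N} (|∂_t u(t,x)|² + |∇_x u(t,x)|²) Ψ(t,x) dx. Then for all t ∈ [0,T]: E_Ψ(t) ≤ E_Ψ(0) − (2/(p+1)) ∫_{ℝ^N} |u₀(x)|^p u₀(x) Ψ(0,x) dx + (2/(p+1)) ∫_{ℝ^N} |u(t,x)|^p u(t,x) Ψ(t,x) dx − (2/(p+1)) ∫_0^t ∫_{ℝ^N} |u(s,x)|^p u(s,x) ∂_t Ψ(s,x) dx ds. -/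

import Mathlib

open Real Set MeasureTheory

/-- The weight function `Ψ(t,x) = (A + ‖x‖²/(1+t))^λ`. -/
noncomputable def weightPsi (N : ℕ) (lam A : ℝ) (t : ℝ) (x : EuclideanSpace ℝ (Fin N)) : ℝ :=
  (A + ‖x‖ ^ 2 / (1 + t)) ^ lam

/-- The spatial Laplacian `Δf(x) = ∑ᵢ ∂²f/∂xᵢ²(x)` of `f : ℝ^N → ℝ`. -/
noncomputable def spatialLaplacian (N : ℕ) (f : EuclideanSpace ℝ (Fin N) → ℝ)
    (x : EuclideanSpace ℝ (Fin N)) : ℝ :=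
  ∑ i : Fin N, fderiv ℝ (fun y => fderiv ℝ f y (EuclideanSpace.single i 1)) x
    (EuclideanSpace.single i 1)

/-- Integral form of differentiation under the integral sign over a compact set. -/
theorem setIntegral_sub_eq_intervalIntegral_deriv {E : Type*} [NormedAddCommGroup E]
    [InnerProductSpace ℝ E] [FiniteDimensional ℝ E] [MeasurableSpace E] [BorelSpace E]
    {f f' : ℝ → E → ℝ} {K : Set E} (hK : IsCompact K) {t : ℝ} (ht : 0 ≤ t)
    (hf : ContinuousOn (fun q : ℝ × E => f q.1 q.2) (Icc 0 t ×ˢ univ))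
    (hf' : ContinuousOn (fun q : ℝ × E => f' q.1 q.2) (Icc 0 t ×ˢ univ))
    (hd : ∀ s ∈ Icc 0 t, ∀ x, HasDerivAt (fun τ => f τ x) (f' s x) s) :
    (∫ x in K, f t x) - ∫ x in K, f 0 x = ∫ s in (0 : ℝ)..t, ∫ x in K, f' s x := by
  have slice : ∀ s ∈ Icc 0 t, IntegrableOn (f s) K := fun s hs => by
    refine ContinuousOn.integrableOn_compact hK ?_
    exact hf.comp (f := fun x : E => (s, x)) (by fun_prop) (fun x _ => ⟨hs, mem_univ _⟩)
  rw [← integral_sub (slice t ⟨ht, le_rfl⟩) (slice 0 ⟨le_rfl, ht⟩)]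
  rw [intervalIntegral_integral_swap]
  · refine integral_congr_ae (Filter.Eventually.of_forall fun x => ?_)
    refine (intervalIntegral.integral_eq_sub_of_hasDerivAt (f := fun τ => f τ x)
      (f' := fun τ => f' τ x) ?_ ?_).symm
    · intro s hs
      rw [uIcc_of_le ht] at hs
      exact hd s hs x
    · refine ContinuousOn.intervalIntegrable ?_
      rw [uIcc_of_le ht]
      exact hf'.comp (f := fun s : ℝ => (s, x)) (by fun_prop) (fun s hs => ⟨hs, mem_univ _⟩)
  · rw [uIoc_of_le ht, Measure.prod_restrict]
    refine IntegrableOn.mono_set (t := Icc 0 t ×ˢ K) ?_ (prod_mono Ioc_subset_Icc_self subset_rfl)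
    exact (hf'.mono (prod_mono subset_rfl (subset_univ _))).integrableOn_compact
      (isCompact_Icc.prod hK)

theorem intervalIntegrable_setIntegral {E : Type*} [NormedAddCommGroup E]
    [InnerProductSpace ℝ E] [FiniteDimensional ℝ E] [MeasurableSpace E] [BorelSpace E]
    {f : ℝ → E → ℝ} {K : Set E} (hK : IsCompact K) {t : ℝ} (ht : 0 ≤ t)
    (hf : ContinuousOn (fun q : ℝ × E => f q.1 q.2) (Icc 0 t ×ˢ univ)) :
    IntervalIntegrable (fun s => ∫ x in K, f s x) volume 0 t := by
  rw [intervalIntegrable_iff_integrableOn_Ioc_of_le ht]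
  refine Integrable.integral_prod_left (f := fun q : ℝ × E => f q.1 q.2) ?_
  rw [Measure.prod_restrict]
  refine IntegrableOn.mono_set (t := Icc 0 t ×ˢ K) ?_ (prod_mono Ioc_subset_Icc_self subset_rfl)
  exact (hf.mono (prod_mono subset_rfl (subset_univ _))).integrableOn_compact
      (isCompact_Icc.prod hK)

theorem integral_fderiv_apply_eq_zero {E : Type*} [NormedAddCommGroup E]
    [InnerProductSpace ℝ E] [FiniteDimensional ℝ E] [MeasurableSpace E] [BorelSpace E]
    {F : E → ℝ} (hF : ContDiff ℝ 1 F) (hc : HasCompactSupport F) (v : E) :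
    ∫ x, fderiv ℝ F x v = 0 := by
  have hi : Integrable (fun x => fderiv ℝ F x v) :=
    ((hF.continuous_fderiv one_ne_zero).clm_apply continuous_const).integrable_of_hasCompactSupport
      (hc.fderiv_apply ℝ v)
  have h := integral_mul_fderiv_eq_neg_fderiv_mul_of_integrable (μ := (volume : Measure E))
    (f := fun _ : E => (1 : ℝ)) (g := F) (v := v)
    (by simp) (by simpa using hi)
    (by simpa using hF.continuous.integrable_of_hasCompactSupport hc)
    (fun x _ => differentiableAt_const _)
    (fun x _ => (hF.differentiable one_ne_zero).differentiableAt)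
  simpa using h

theorem hasDerivAt_abs_rpow_mul_self {p : ℝ} (hp : 1 < p) (y : ℝ) :
    HasDerivAt (fun y : ℝ => |y| ^ p * y) ((p + 1) * |y| ^ p) y := by
  refine ((hasDerivAt_abs_rpow y hp).mul (hasDerivAt_id y)).congr_deriv ?_
  rcases eq_or_ne y 0 with rfl | hy
  · simp [Real.zero_rpow (by linarith : p ≠ 0)]
  · have h : |y| ^ p = |y| ^ (p - 2) * y ^ 2 := by
      rw [← sq_abs, ← Real.rpow_natCast, ← Real.rpow_add (abs_pos.2 hy)]
      norm_num
    simp only [id, h]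
    ring

section Weight

variable {N : ℕ} {lam A : ℝ}

theorem weight_base_pos (hA : 0 < A) {t : ℝ} (ht : 0 ≤ t) (x : EuclideanSpace ℝ (Fin N)) :
    0 < A + ‖x‖ ^ 2 / (1 + t) := by positivity

/-- The time derivative of `weightPsi`. -/
noncomputable def weightPsiTime (N : ℕ) (lam A t : ℝ) (x : EuclideanSpace ℝ (Fin N)) : ℝ :=
  lam * (A + ‖x‖ ^ 2 / (1 + t)) ^ (lam - 1) * (-(‖x‖ ^ 2 / (1 + t) ^ 2))

/-- The partial derivatives of `weightPsi` in space. -/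
noncomputable def weightPsiSpace (N : ℕ) (lam A t : ℝ) (x : EuclideanSpace ℝ (Fin N))
    (i : Fin N) : ℝ :=
  lam * (A + ‖x‖ ^ 2 / (1 + t)) ^ (lam - 1) * (2 * (x i / (1 + t)))

theorem hasDerivAt_weightPsi_time (hA : 0 < A) {t : ℝ} (ht : 0 ≤ t)
    (x : EuclideanSpace ℝ (Fin N)) :
    HasDerivAt (fun τ => weightPsi N lam A τ x) (weightPsiTime N lam A t x) t := by
  have h1 : HasDerivAt (fun τ : ℝ => A + ‖x‖ ^ 2 / (1 + τ)) (-(‖x‖ ^ 2 / (1 + t) ^ 2)) t := by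
    have := ((hasDerivAt_const t (‖x‖ ^ 2)).div ((hasDerivAt_id t).const_add 1)
      (by simp only [id]; positivity)).const_add A
    refine this.congr_deriv ?_
    simp only [id]
    ring
  refine (h1.rpow_const (p := lam) (Or.inl (weight_base_pos hA ht x).ne')).congr_deriv ?_
  unfold weightPsiTime
  ring

theorem hasLineDerivAt_weightPsi (hA : 0 < A) {t : ℝ} (ht : 0 ≤ t)
    (x : EuclideanSpace ℝ (Fin N)) (i : Fin N) :
    HasLineDerivAt ℝ (weightPsi N lam A t) (weightPsiSpace N lam A t x i) x
      (EuclideanSpace.single i 1) := by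
  unfold HasLineDerivAt
  have h0 : HasDerivAt (fun s : ℝ => x + s • (EuclideanSpace.single i (1 : ℝ)))
      (EuclideanSpace.single i (1 : ℝ)) 0 := by
    simpa using ((hasDerivAt_id (0 : ℝ)).smul_const (EuclideanSpace.single i (1 : ℝ))).const_add x
  have h1 := (h0.norm_sq.div_const (1 + t)).const_add A
  refine (h1.rpow_const (p := lam) (Or.inl (weight_base_pos hA ht _).ne')).congr_deriv ?_
  unfold weightPsiSpace
  simp [EuclideanSpace.inner_single_right]
  ring

theorem contDiff_weightPsi (hA : 0 < A) {t : ℝ} (ht : 0 ≤ t) :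
    ContDiff ℝ 1 (weightPsi N lam A t) := by
  have : ContDiff ℝ 1 (fun x : EuclideanSpace ℝ (Fin N) => A + ‖x‖ ^ 2 / (1 + t)) :=
    contDiff_const.add ((contDiff_norm_sq ℝ).div_const _)
  exact this.rpow_const_of_ne fun x => (weight_base_pos hA ht x).ne'

theorem continuousOn_weight_base_rpow (hA : 0 < A) (r : ℝ) :
    ContinuousOn (fun q : ℝ × EuclideanSpace ℝ (Fin N) => (A + ‖q.2‖ ^ 2 / (1 + q.1)) ^ r)
      (Ici 0 ×ˢ univ) := by
  refine ContinuousOn.rpow_const ?_ fun q hq => Or.inl (weight_base_pos hA hq.1 q.2).ne'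
  refine continuousOn_const.add (ContinuousOn.div (by fun_prop) (by fun_prop) fun q hq => ?_)
  have : (0 : ℝ) ≤ q.1 := hq.1
  positivity

theorem continuousOn_weightPsiTime (hA : 0 < A) :
    ContinuousOn (fun q : ℝ × EuclideanSpace ℝ (Fin N) => weightPsiTime N lam A q.1 q.2)
      (Ici 0 ×ˢ univ) := by
  refine (continuousOn_const.mul (continuousOn_weight_base_rpow hA (lam - 1))).mul
    (ContinuousOn.neg (ContinuousOn.div (by fun_prop) (by fun_prop) fun q hq => ?_))
  have : (0 : ℝ) ≤ q.1 := hq.1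
  positivity

/-- The weight absorbs the cross term of the energy identity because `2 * lam ≤ A`. -/
theorem weight_cross_term_le (hlam : 0 < lam) (hA : 2 * lam ≤ A) {t : ℝ} (ht : 0 ≤ t)
    (x : EuclideanSpace ℝ (Fin N)) (a : ℝ) (b : Fin N → ℝ) :
    (a ^ 2 + ∑ i, b i ^ 2) * weightPsiTime N lam A t x - 2 * a ^ 2 * weightPsi N lam A t x
      - 2 * ∑ i, a * b i * weightPsiSpace N lam A t x i ≤ 0 := by
  have hψ : 0 < A + ‖x‖ ^ 2 / (1 + t) := weight_base_pos (by linarith) ht x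
  set ψ := A + ‖x‖ ^ 2 / (1 + t) with hψdef
  set m := lam * ψ ^ (lam - 1) with hm
  have hpow : 0 < ψ ^ (lam - 1) := Real.rpow_pos_of_pos hψ _
  have hm0 : 0 < m := mul_pos hlam hpow
  have hW : weightPsi N lam A t x = ψ * ψ ^ (lam - 1) := by
    unfold weightPsi
    rw [← hψdef, ← Real.rpow_one_add' hψ.le (by linarith)]
    congr 1
    ring
  have hWm : 2 * m ≤ weightPsi N lam A t x := by
    have : 2 * lam ≤ ψ := hA.trans (le_add_of_nonneg_right (by positivity))
    rw [hW, hm, ← mul_assoc]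
    exact mul_le_mul_of_nonneg_right this hpow.le
  have hsum : ‖x‖ ^ 2 / (1 + t) ^ 2 = ∑ i, (x i / (1 + t)) ^ 2 := by
    rw [EuclideanSpace.real_norm_sq_eq, Finset.sum_div]
    exact Finset.sum_congr rfl fun i _ => (div_pow _ _ _).symm
  have hcs := Finset.sum_mul_sq_le_sq_mul_sq Finset.univ b fun i => x i / (1 + t)
  have hcross : ∑ i, a * b i * weightPsiSpace N lam A t x i
      = 2 * m * a * ∑ i, b i * (x i / (1 + t)) := by
    rw [Finset.mul_sum]
    refine Finset.sum_congr rfl fun i _ => ?_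
    simp only [weightPsiSpace, ← hψdef, ← hm]
    ring
  have hT : weightPsiTime N lam A t x = -(m * ∑ i, (x i / (1 + t)) ^ 2) := by
    rw [← hsum]
    simp only [weightPsiTime, ← hψdef, ← hm]
    ring
  have hy : 0 ≤ ∑ i, (x i / (1 + t)) ^ 2 := Finset.sum_nonneg fun i _ => sq_nonneg _
  rw [hcross, hT]
  set Y := ∑ i, (x i / (1 + t)) ^ 2
  set B := ∑ i, b i ^ 2
  set S := ∑ i, b i * (x i / (1 + t))
  have e1 : a ^ 2 * (2 * m) ≤ a ^ 2 * weightPsi N lam A t x :=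
    mul_le_mul_of_nonneg_left hWm (sq_nonneg a)
  have e2 : 0 ≤ m * (B * Y - S ^ 2) := mul_nonneg hm0.le (by linarith)
  have e3 : 0 ≤ m * (2 * a + S) ^ 2 := mul_nonneg hm0.le (sq_nonneg _)
  have e4 : 0 ≤ m * (a ^ 2 * Y) := by positivity
  nlinarith

end Weight

theorem ContDiff.hasDerivAt_comp_fst {E : Type*} [NormedAddCommGroup E] [NormedSpace ℝ E]
    {V : ℝ × E → ℝ} {n : WithTop ℕ∞} (hV : ContDiff ℝ n V) (hn : n ≠ 0) (t : ℝ) (x : E) :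
    HasDerivAt (fun τ => V (τ, x)) (fderiv ℝ V (t, x) (1, 0)) t :=
  ((hV.differentiable hn).differentiableAt.hasFDerivAt (x := (t, x))).comp_hasDerivAt t
    ((hasDerivAt_id t).prodMk (hasDerivAt_const t x))

theorem ContDiff.hasFDerivAt_comp_snd {E : Type*} [NormedAddCommGroup E] [NormedSpace ℝ E]
    {V : ℝ × E → ℝ} {n : WithTop ℕ∞} (hV : ContDiff ℝ n V) (hn : n ≠ 0) (t : ℝ) (x : E) :
    HasFDerivAt (fun y => V (t, y)) ((fderiv ℝ V (t, x)).comp (.inr ℝ ℝ E)) x :=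
  ((hV.differentiable hn).differentiableAt.hasFDerivAt (x := (t, x))).comp x
    (hasFDerivAt_prodMk_right t x)

theorem ContDiff.fderiv_fderiv_apply_comm {E : Type*} [NormedAddCommGroup E] [NormedSpace ℝ E]
    {V : E → ℝ} (hV : ContDiff ℝ 2 V) (q v w : E) :
    fderiv ℝ (fun q' => fderiv ℝ V q' v) q w = fderiv ℝ (fun q' => fderiv ℝ V q' w) q v := by
  have hd : DifferentiableAt ℝ (fderiv ℝ V) q :=
    ((hV.fderiv_right (m := 1) (by norm_num)).differentiable one_ne_zero).differentiableAt
  have h : ∀ z, fderiv ℝ (fun q' => fderiv ℝ V q' z) q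
      = (fderiv ℝ (fderiv ℝ V) q).flip z := fun z => by
    rw [fderiv_clm_apply hd (differentiableAt_const z)]
    simp
  rw [h, h]
  exact hV.contDiffAt.isSymmSndFDerivAt (by simp) w v

theorem norm_gradient_sq_eq_sum {N : ℕ} (f : EuclideanSpace ℝ (Fin N) → ℝ)
    (x : EuclideanSpace ℝ (Fin N)) :
    ‖gradient f x‖ ^ 2 = ∑ i, (fderiv ℝ f x (EuclideanSpace.single i 1)) ^ 2 := by
  rw [EuclideanSpace.real_norm_sq_eq]
  refine Finset.sum_congr rfl fun i _ => ?_
  have h : inner ℝ (gradient f x) (EuclideanSpace.single i (1 : ℝ))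
      = fderiv ℝ f x (EuclideanSpace.single i 1) := by
    simp [gradient]
  rw [← h, EuclideanSpace.inner_single_right]
  simp

/-- A directional derivative of a function vanishing off a closed set during a time interval also
vanishes there, up to and including the endpoints of the interval. -/
theorem fderiv_apply_eq_zero_of_notMem {E : Type*} [NormedAddCommGroup E] [NormedSpace ℝ E]
    {V : ℝ × E → ℝ} (hV : ContDiff ℝ 1 V) {T : ℝ} (hT : 0 < T) {K : Set E} (hK : IsClosed K)
    (h : ∀ t ∈ Icc 0 T, ∀ x ∉ K, V (t, x) = 0) (v : ℝ × E) {t : ℝ} (ht : t ∈ Icc 0 T)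
    {x : E} (hx : x ∉ K) : fderiv ℝ V (t, x) v = 0 := by
  have hint : ∀ s ∈ Ioo 0 T, fderiv ℝ V (s, x) v = 0 := fun s hs => by
    have : V =ᶠ[nhds (s, x)] fun _ => 0 := by
      filter_upwards [(isOpen_Ioo.prod hK.isOpen_compl).mem_nhds ⟨hs, hx⟩] with q hq
      exact h q.1 (Ioo_subset_Icc_self hq.1) q.2 hq.2
    rw [this.fderiv_eq]
    simp
  have hcl : IsClosed {s : ℝ | fderiv ℝ V (s, x) v = 0} :=
    isClosed_eq (((hV.continuous_fderiv one_ne_zero).comp (by fun_prop)).clm_apply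
      continuous_const) continuous_const
  have := hcl.closure_subset_iff.2 hint
  rw [closure_Ioo hT.ne] at this
  exact this ht


/-- weighted energy inequality for compactly supported `C²` solutions of
`∂ₜ²u - Δu + ∂ₜu = |u|^p` with weight `Ψ(t,x) = (A + ‖x‖²/(1+t))^λ`, `A ≥ 2λ`. -/
theorem stmt_5 (N : ℕ) (hN : 1 ≤ N) (p lam A : ℝ) (hp : 1 < p) (hlam : 0 < lam)
    (hA : 2 * lam ≤ A) (T : ℝ) (hT : 0 < T)
    (u : ℝ → EuclideanSpace ℝ (Fin N) → ℝ) (u₀ : EuclideanSpace ℝ (Fin N) → ℝ)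
    (hu : ContDiff ℝ 2 (fun q : ℝ × EuclideanSpace ℝ (Fin N) => u q.1 q.2))
    (K : Set (EuclideanSpace ℝ (Fin N))) (hK : IsCompact K)
    (hsupp : ∀ t ∈ Set.Icc (0 : ℝ) T, ∀ x ∉ K, u t x = 0)
    (hinit : ∀ x, u 0 x = u₀ x)
    (hpde : ∀ t ∈ Set.Ioo (0 : ℝ) T, ∀ x,
      deriv (fun τ : ℝ => deriv (fun σ : ℝ => u σ x) τ) t
        - spatialLaplacian N (u t) x
        + deriv (fun τ : ℝ => u τ x) t = |u t x| ^ p) :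
    ∀ t ∈ Set.Icc (0 : ℝ) T,
      (∫ x, ((deriv (fun τ : ℝ => u τ x) t) ^ 2 + ‖gradient (u t) x‖ ^ 2)
          * weightPsi N lam A t x)
        ≤ (∫ x, ((deriv (fun τ : ℝ => u τ x) 0) ^ 2 + ‖gradient (u 0) x‖ ^ 2)
              * weightPsi N lam A 0 x)
          - (2 / (p + 1)) * (∫ x, |u₀ x| ^ p * u₀ x * weightPsi N lam A 0 x)
          + (2 / (p + 1)) * (∫ x, |u t x| ^ p * u t x * weightPsi N lam A t x)
          - (2 / (p + 1)) * ∫ s in (0 : ℝ)..t,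
              ∫ x, |u s x| ^ p * u s x * deriv (fun τ : ℝ => weightPsi N lam A τ x) s := by
  intro t ht
  have hA0 : 0 < A := by linarith
  have hp1 : p + 1 ≠ 0 := by linarith
  set U : ℝ × EuclideanSpace ℝ (Fin N) → ℝ := fun q => u q.1 q.2
  let e : Fin N → EuclideanSpace ℝ (Fin N) := fun i => EuclideanSpace.single i 1
  let D : ℝ × EuclideanSpace ℝ (Fin N) → ℝ × EuclideanSpace ℝ (Fin N) → ℝ :=
    fun v q => fderiv ℝ U q v
  let D2 : ℝ × EuclideanSpace ℝ (Fin N) → ℝ × EuclideanSpace ℝ (Fin N) →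
      ℝ × EuclideanSpace ℝ (Fin N) → ℝ := fun v w q => fderiv ℝ (D v) q w
  have hD1 : ∀ v, ContDiff ℝ 1 (D v) := fun v =>
    (hu.fderiv_right (m := 1) (by norm_num)).clm_apply contDiff_const
  have hUcont : Continuous U := hu.continuous
  have hDcont : ∀ v, Continuous (D v) := fun v => (hD1 v).continuous
  have hD2cont : ∀ v w, Continuous (D2 v w) := fun v w =>
    ((hD1 v).continuous_fderiv one_ne_zero).clm_apply continuous_const
  have hD2comm : ∀ v w q, D2 v w q = D2 w v q := fun v w q => hu.fderiv_fderiv_apply_comm q v w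
  have hUt : ∀ s x, HasDerivAt (fun τ => u τ x) (D (1, 0) (s, x)) s := fun s x =>
    hu.hasDerivAt_comp_fst two_ne_zero s x
  have hDt : ∀ v s x, HasDerivAt (fun τ => D v (τ, x)) (D2 v (1, 0) (s, x)) s := fun v s x =>
    (hD1 v).hasDerivAt_comp_fst one_ne_zero s x
  have hUx : ∀ s x i, fderiv ℝ (u s) x (e i) = D (0, e i) (s, x) := fun s x i => by
    have := (hu.hasFDerivAt_comp_snd two_ne_zero s x).fderiv
    change fderiv ℝ (fun y => U (s, y)) x (e i) = _
    rw [this]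
    simp [D]
  have hDx : ∀ v s x i, HasLineDerivAt ℝ (fun y => D v (s, y)) (D2 v (0, e i) (s, x)) x (e i) :=
    fun v s x i => by
      simpa [D2] using ((hD1 v).hasFDerivAt_comp_snd one_ne_zero s x).hasLineDerivAt (e i)
  have hlap : ∀ s x, spatialLaplacian N (u s) x = ∑ i, D2 (0, e i) (0, e i) (s, x) := fun s x => by
    refine Finset.sum_congr rfl fun i _ => ?_
    have : (fun y => fderiv ℝ (u s) y (EuclideanSpace.single i 1))
        = fun y => D (0, e i) (s, y) := funext fun y => hUx s y i
    rw [this, ((hD1 _).hasFDerivAt_comp_snd one_ne_zero s x).fderiv]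
    simp [D2, e]
  have hut : ∀ s x, deriv (fun τ => u τ x) s = D (1, 0) (s, x) := fun s x => (hUt s x).deriv
  have hutt : ∀ s x, deriv (fun τ => deriv (fun σ => u σ x) τ) s = D2 (1, 0) (1, 0) (s, x) :=
    fun s x => by
      simp only [hut]
      exact (hDt _ s x).deriv
  have hgrad : ∀ s x, ‖gradient (u s) x‖ ^ 2 = ∑ i, D (0, e i) (s, x) ^ 2 := fun s x => by
    rw [norm_gradient_sq_eq_sum]
    exact Finset.sum_congr rfl fun i _ => by rw [← hUx]
  have hDzero : ∀ v, ∀ s ∈ Icc 0 T, ∀ x ∉ K, D v (s, x) = 0 := fun v s hs x hx =>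
    fderiv_apply_eq_zero_of_notMem (hu.of_le one_le_two) hT hK.isClosed hsupp v hs hx
  have hWcont : ContinuousOn (fun q : ℝ × EuclideanSpace ℝ (Fin N) => weightPsi N lam A q.1 q.2)
      (Ici 0 ×ˢ univ) := continuousOn_weight_base_rpow hA0 lam
  have hWtcont := continuousOn_weightPsiTime (N := N) (lam := lam) hA0
  have hpowcont : Continuous fun q : ℝ × EuclideanSpace ℝ (Fin N) => |u q.1 q.2| ^ p :=
    hUcont.abs.rpow_const fun _ => Or.inr (by linarith)
  have hsub : Icc 0 t ×ˢ univ ⊆ Ici (0 : ℝ) ×ˢ (univ : Set (EuclideanSpace ℝ (Fin N))) :=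
    prod_mono Icc_subset_Ici_self subset_rfl
  -- the energy density, the nonlinear density, and the forcing density
  let en : ℝ → EuclideanSpace ℝ (Fin N) → ℝ := fun s x =>
    (D (1, 0) (s, x) ^ 2 + ∑ i, D (0, e i) (s, x) ^ 2) * weightPsi N lam A s x
  let nl : ℝ → EuclideanSpace ℝ (Fin N) → ℝ := fun s x =>
    |u s x| ^ p * u s x * weightPsi N lam A s x
  let fo : ℝ → EuclideanSpace ℝ (Fin N) → ℝ := fun s x =>
    |u s x| ^ p * u s x * weightPsiTime N lam A s x
  let en' : ℝ → EuclideanSpace ℝ (Fin N) → ℝ := fun s x =>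
    (2 * D (1, 0) (s, x) * D2 (1, 0) (1, 0) (s, x)
        + ∑ i, 2 * D (0, e i) (s, x) * D2 (0, e i) (1, 0) (s, x)) * weightPsi N lam A s x
      + (D (1, 0) (s, x) ^ 2 + ∑ i, D (0, e i) (s, x) ^ 2) * weightPsiTime N lam A s x
  let nl' : ℝ → EuclideanSpace ℝ (Fin N) → ℝ := fun s x =>
    (p + 1) * |u s x| ^ p * D (1, 0) (s, x) * weightPsi N lam A s x + fo s x
  have hen : ContinuousOn (fun q : ℝ × EuclideanSpace ℝ (Fin N) => en q.1 q.2) (Ici 0 ×ˢ univ) :=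
    ContinuousOn.mul (by fun_prop) hWcont
  have hnl : ContinuousOn (fun q : ℝ × EuclideanSpace ℝ (Fin N) => nl q.1 q.2) (Ici 0 ×ˢ univ) :=
    ContinuousOn.mul (hpowcont.mul hUcont).continuousOn hWcont
  have hfo : ContinuousOn (fun q : ℝ × EuclideanSpace ℝ (Fin N) => fo q.1 q.2) (Ici 0 ×ˢ univ) :=
    ContinuousOn.mul (hpowcont.mul hUcont).continuousOn hWtcont
  have hen' : ContinuousOn (fun q : ℝ × EuclideanSpace ℝ (Fin N) => en' q.1 q.2)
      (Ici 0 ×ˢ univ) :=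
    (ContinuousOn.mul (by fun_prop) hWcont).add (ContinuousOn.mul (by fun_prop) hWtcont)
  have hnl' : ContinuousOn (fun q : ℝ × EuclideanSpace ℝ (Fin N) => nl' q.1 q.2)
      (Ici 0 ×ˢ univ) :=
    (ContinuousOn.mul ((continuous_const.mul hpowcont).mul (hDcont _)).continuousOn hWcont).add hfo
  have hend : ∀ s ∈ Icc 0 t, ∀ x, HasDerivAt (fun τ => en τ x) (en' s x) s := fun s hs x => by
    have h1 : HasDerivAt (fun τ => D (1, 0) (τ, x) ^ 2 + ∑ i, D (0, e i) (τ, x) ^ 2)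
        (2 * D (1, 0) (s, x) * D2 (1, 0) (1, 0) (s, x)
          + ∑ i, 2 * D (0, e i) (s, x) * D2 (0, e i) (1, 0) (s, x)) s := by
      refine HasDerivAt.add ?_ (HasDerivAt.fun_sum fun i _ => ?_)
      · exact ((hDt (1, 0) s x).fun_pow 2).congr_deriv (by norm_num)
      · exact ((hDt (0, e i) s x).fun_pow 2).congr_deriv (by norm_num)
    exact h1.mul (hasDerivAt_weightPsi_time hA0 hs.1 x)
  have hnld : ∀ s ∈ Icc 0 t, ∀ x, HasDerivAt (fun τ => nl τ x) (nl' s x) s := fun s hs x => by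
    have h1 : HasDerivAt (fun τ => |u τ x| ^ p * u τ x)
        ((p + 1) * |u s x| ^ p * D (1, 0) (s, x)) s :=
      HasDerivAt.comp (h₂ := fun y : ℝ => |y| ^ p * y) s
        (hasDerivAt_abs_rpow_mul_self hp (u s x)) (hUt s x)
    exact h1.mul (hasDerivAt_weightPsi_time hA0 hs.1 x)
  have henint := setIntegral_sub_eq_intervalIntegral_deriv hK ht.1 (hen.mono hsub) (hen'.mono hsub)
    hend
  have hnlint := setIntegral_sub_eq_intervalIntegral_deriv hK ht.1 (hnl.mono hsub) (hnl'.mono hsub)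
    hnld
  have hslice : ∀ g : ℝ → EuclideanSpace ℝ (Fin N) → ℝ,
      ContinuousOn (fun q : ℝ × EuclideanSpace ℝ (Fin N) => g q.1 q.2) (Ici 0 ×ˢ univ) →
      ∀ s, 0 ≤ s → IntegrableOn (g s) K := fun g hg s hs =>
    ContinuousOn.integrableOn_compact hK
      (hg.comp (f := fun x => (s, x)) (by fun_prop) fun x _ => ⟨hs, mem_univ _⟩)
  -- the differential inequality, in integrated form
  have hdiff : ∀ s ∈ Ioo 0 t, (∫ x in K, en' s x)
      ≤ 2 / (p + 1) * (∫ x in K, nl' s x) - 2 / (p + 1) * ∫ x in K, fo s x := fun s hs => by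
    have hsT : s ∈ Ioo 0 T := ⟨hs.1, hs.2.trans_le ht.2⟩
    have hsT' := Ioo_subset_Icc_self hsT
    let F : Fin N → EuclideanSpace ℝ (Fin N) → ℝ := fun i x =>
      D (1, 0) (s, x) * D (0, e i) (s, x) * weightPsi N lam A s x
    have hF : ∀ i, ContDiff ℝ 1 (F i) := fun i =>
      (((hD1 _).comp (contDiff_prodMk_right s)).mul ((hD1 _).comp (contDiff_prodMk_right s))).mul
        (contDiff_weightPsi hA0 hs.1.le)
    have hF0 : ∀ i, ∀ x ∉ K, F i x = 0 := fun i x hx => by simp [F, hDzero _ s hsT' x hx]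
    have hFint : ∀ i, ∫ x in K, fderiv ℝ (F i) x (e i) = 0 := fun i => by
      rw [setIntegral_eq_integral_of_forall_compl_eq_zero]
      · exact integral_fderiv_apply_eq_zero (hF i) (HasCompactSupport.intro hK (hF0 i)) _
      · intro x hx
        have : F i =ᶠ[nhds x] fun _ => 0 := by
          filter_upwards [hK.isClosed.isOpen_compl.mem_nhds hx] with y hy
          exact hF0 i y hy
        rw [this.fderiv_eq]
        simp
    have hFd : ∀ i x, fderiv ℝ (F i) x (e i)
        = (D2 (1, 0) (0, e i) (s, x) * D (0, e i) (s, x)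
            + D (1, 0) (s, x) * D2 (0, e i) (0, e i) (s, x)) * weightPsi N lam A s x
          + D (1, 0) (s, x) * D (0, e i) (s, x) * weightPsiSpace N lam A s x i := fun i x => by
      rw [← ((hF i).differentiable one_ne_zero).differentiableAt.lineDeriv_eq_fderiv]
      have h1 := hDx (1, 0) s x i
      have h2 := hDx (0, e i) s x i
      have h3 := hasLineDerivAt_weightPsi (lam := lam) hA0 hs.1.le x i
      unfold HasLineDerivAt at h1 h2 h3
      simpa [F] using (show HasLineDerivAt ℝ (F i) _ x (e i) from (h1.mul h2).mul h3).lineDeriv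
    have hFi : ∀ i, IntegrableOn (fun x => fderiv ℝ (F i) x (e i)) K := fun i =>
      (((hF i).continuous_fderiv one_ne_zero).clm_apply
        continuous_const).continuousOn.integrableOn_compact hK
    have hpt : ∀ x, en' s x ≤ 2 / (p + 1) * nl' s x - 2 / (p + 1) * fo s x
        + 2 * ∑ i, fderiv ℝ (F i) x (e i) := fun x => by
      have hcr := weight_cross_term_le hlam hA hs.1.le x (D (1, 0) (s, x))
        fun i => D (0, e i) (s, x)
      have heq := hpde s hsT x
      rw [hutt, hlap, hut] at heq
      have hsum : ∑ i, fderiv ℝ (F i) x (e i)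
          = ((∑ i, D (0, e i) (s, x) * D2 (0, e i) (1, 0) (s, x))
              + D (1, 0) (s, x) * ∑ i, D2 (0, e i) (0, e i) (s, x)) * weightPsi N lam A s x
            + ∑ i, D (1, 0) (s, x) * D (0, e i) (s, x) * weightPsiSpace N lam A s x i := by
        rw [Finset.mul_sum, ← Finset.sum_add_distrib, Finset.sum_mul, ← Finset.sum_add_distrib]
        refine Finset.sum_congr rfl fun i _ => ?_
        rw [hFd, hD2comm (1, 0)]
        ring
      have hnlc : 2 / (p + 1) * nl' s x - 2 / (p + 1) * fo s x
          = 2 * |u s x| ^ p * D (1, 0) (s, x) * weightPsi N lam A s x := by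
        simp only [nl']
        field_simp
        ring
      have htwo : ∑ i, 2 * D (0, e i) (s, x) * D2 (0, e i) (1, 0) (s, x)
          = 2 * ∑ i, D (0, e i) (s, x) * D2 (0, e i) (1, 0) (s, x) := by
        rw [Finset.mul_sum]
        exact Finset.sum_congr rfl fun i _ => by ring
      rw [hnlc, hsum]
      simp only [en']
      rw [htwo]
      have hacc : D2 (1, 0) (1, 0) (s, x)
          = ∑ i, D2 (0, e i) (0, e i) (s, x) - D (1, 0) (s, x) + |u s x| ^ p := by linarith
      rw [hacc]
      linear_combination hcr
    have hI1 := (hslice nl' hnl' s hs.1.le).const_mul (2 / (p + 1))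
    have hI2 := (hslice fo hfo s hs.1.le).const_mul (2 / (p + 1))
    have hI3 := (integrable_finsetSum Finset.univ fun i _ => hFi i).const_mul 2
    have hI12 : IntegrableOn (fun x => 2 / (p + 1) * nl' s x - 2 / (p + 1) * fo s x) K :=
      hI1.sub hI2
    refine (integral_mono (hslice en' hen' s hs.1.le) (hI12.add hI3) hpt).trans_eq ?_
    simp only [Pi.add_apply]
    rw [integral_add hI12 hI3, integral_sub hI1 hI2, integral_const_mul, integral_const_mul,
      integral_const_mul, integral_finsetSum _ fun i _ => hFi i]
    simp [hFint]
  have hIen' := intervalIntegrable_setIntegral hK ht.1 (hen'.mono hsub)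
  have hInl' := intervalIntegrable_setIntegral hK ht.1 (hnl'.mono hsub)
  have hIfo := intervalIntegrable_setIntegral hK ht.1 (hfo.mono hsub)
  have hmain := intervalIntegral.integral_mono_on_of_le_Ioo ht.1 hIen'
    ((hInl'.const_mul (2 / (p + 1))).sub (hIfo.const_mul (2 / (p + 1)))) hdiff
  rw [intervalIntegral.integral_sub (hInl'.const_mul _) (hIfo.const_mul _),
    intervalIntegral.integral_const_mul, intervalIntegral.integral_const_mul, ← henint, ← hnlint]
    at hmain
  -- all integrals over the whole space localize to `K`
  have henK : ∀ s ∈ Icc 0 T, (∫ x, ((deriv (fun τ : ℝ => u τ x) s) ^ 2 + ‖gradient (u s) x‖ ^ 2)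
      * weightPsi N lam A s x) = ∫ x in K, en s x := fun s hs => by
    rw [setIntegral_eq_integral_of_forall_compl_eq_zero]
    · simp only [hut, hgrad, en]
    · intro x hx
      simp [en, hDzero _ s hs x hx]
  have hnlK : ∀ s ∈ Icc 0 T, (∫ x, |u s x| ^ p * u s x * weightPsi N lam A s x)
      = ∫ x in K, nl s x := fun s hs => by
    rw [setIntegral_eq_integral_of_forall_compl_eq_zero]
    intro x hx
    simp [nl, hsupp s hs x hx]
  have hfoK : (∫ s in (0 : ℝ)..t, ∫ x, |u s x| ^ p * u s x
      * deriv (fun τ : ℝ => weightPsi N lam A τ x) s) = ∫ s in (0 : ℝ)..t, ∫ x in K, fo s x := by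
    refine intervalIntegral.integral_congr fun s hs => ?_
    rw [uIcc_of_le ht.1] at hs
    have hs' : s ∈ Icc 0 T := ⟨hs.1, hs.2.trans ht.2⟩
    simp only [(hasDerivAt_weightPsi_time hA0 hs.1 _).deriv]
    rw [setIntegral_eq_integral_of_forall_compl_eq_zero]
    intro x hx
    simp [fo, hsupp s hs' x hx]
  have h0 : (0 : ℝ) ∈ Icc 0 T := ⟨le_rfl, hT.le⟩
  simp only [← hinit]
  rw [henK t ht, henK 0 h0, hnlK t ht, hnlK 0 h0, hfoK]
  linarith
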